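/- The series Σ_{k=2}^{∞} (4/(k(k+1)(k+2)))·√((k(5k+21) − 18)/(2(k+3))) converges and its sum is at most 0.96. -/

import Mathlib

/-- The term `nₖ √(3 n_{k,1}/nₖ + k) = (4/(k(k+1)(k+2))) √((k(5k+21) - 18)/(2(k+3)))`
of the Barabási–Albert bound. -/
noncomputable def baTerm (k : ℕ) : ℝ :=
  4 / ((k : ℝ) * ((k : ℝ) + 1) * ((k : ℝ) + 2)) *
    Real.sqrt (((k : ℝ) * (5 * (k : ℝ) + 21) - 18) / (2 * ((k : ℝ) + 3)))

/-- A telescoping majorant for the tails of the series `∑ baTerm k`. -/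
noncomputable def tailBound (x : ℝ) : ℝ :=
  8 / 3 * Real.sqrt (5 / 2 * (x + 23 / 50)) / (x + 23 / 50) ^ 2

lemma sqrt_mul_half_sub_ge {p : ℝ} (hp : 2 ≤ p) :
    Real.sqrt (5 / 2 * p) * (1 - 1 / (4 * p) - 1 / (32 * p ^ 2) - 1 / (64 * p ^ 3)) ≤
      Real.sqrt (5 / 2 * (p - 1 / 2)) := by
  apply Real.le_sqrt_of_sq_le
  rw [mul_pow, Real.sq_sqrt (by linarith)]
  obtain ⟨m, rfl⟩ : ∃ m, p = m + 2 := ⟨p - 2, by ring⟩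
  have hm : 0 ≤ m := by linarith
  rw [← sub_nonneg]
  field_simp
  ring_nf
  positivity

lemma sqrt_mul_half_add_le {p : ℝ} (hp : 2 ≤ p) :
    Real.sqrt (5 / 2 * (p + 1 / 2)) ≤
      Real.sqrt (5 / 2 * p) * (1 + 1 / (4 * p) - 1 / (32 * p ^ 2) + 1 / (128 * p ^ 3)) := by
  obtain ⟨m, rfl⟩ : ∃ m, p = m + 2 := ⟨p - 2, by ring⟩
  have hm : 0 ≤ m := by linarith
  apply Real.sqrt_le_iff.mpr ⟨mul_nonneg (Real.sqrt_nonneg _) ?_, ?_⟩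
  · field_simp
    ring_nf
    positivity
  · rw [mul_pow, Real.sq_sqrt (by linarith), ← sub_nonneg]
    field_simp
    ring_nf
    positivity

lemma sqrt_le_sqrt_mul {x q : ℝ} (hx : 0 ≤ x) (hq : 0 < q) :
    Real.sqrt x ≤ Real.sqrt q * ((x / q + 1) / 2) := by
  apply Real.sqrt_le_iff.mpr ⟨by positivity, ?_⟩
  rw [mul_pow, Real.sq_sqrt hq.le, ← sub_nonneg]
  have h : q * ((x / q + 1) / 2) ^ 2 - x = (x - q) ^ 2 / (4 * q) := by
    field_simp
    ring
  rw [h]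
  positivity

lemma rational_step {k p : ℝ} (hk : 2 ≤ k) (hp : p = k + 24 / 25) :
    4 / (k * (k + 1) * (k + 2)) *
        (((k * (5 * k + 21) - 18) / (2 * (k + 3)) / (5 / 2 * p) + 1) / 2) ≤
      8 / 3 * (1 - 1 / (4 * p) - 1 / (32 * p ^ 2) - 1 / (64 * p ^ 3)) / (p - 1 / 2) ^ 2 -
      8 / 3 * (1 + 1 / (4 * p) - 1 / (32 * p ^ 2) + 1 / (128 * p ^ 3)) / (p + 1 / 2) ^ 2 := by
  obtain ⟨m, rfl⟩ : ∃ m, k = m + 2 := ⟨k - 2, by ring⟩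
  have hm : 0 ≤ m := by linarith
  have h0 : 0 < p := by linarith
  have h1 : 0 < p - 1 / 2 := by linarith
  have h2 : 0 < p + 1 / 2 := by linarith
  have hL : 8 / 3 * (1 - 1 / (4 * p) - 1 / (32 * p ^ 2) - 1 / (64 * p ^ 3)) / (p - 1 / 2) ^ 2 -
      8 / 3 * (1 + 1 / (4 * p) - 1 / (32 * p ^ 2) + 1 / (128 * p ^ 3)) / (p + 1 / 2) ^ 2 =
      ((64 * p ^ 3 - 16 * p ^ 2 - 2 * p - 1) * 2 * (p + 1 / 2) ^ 2 -
        (128 * p ^ 3 + 32 * p ^ 2 - 4 * p + 1) * (p - 1 / 2) ^ 2) /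
        (48 * p ^ 3 * ((p - 1 / 2) ^ 2 * (p + 1 / 2) ^ 2)) := by
    generalize p - 1 / 2 = u at *
    generalize p + 1 / 2 = v at *
    field_simp
    ring
  have hR : 4 / ((m + 2) * (m + 2 + 1) * (m + 2 + 2)) *
        ((((m + 2) * (5 * (m + 2) + 21) - 18) / (2 * (m + 2 + 3)) / (5 / 2 * p) + 1) / 2) =
      2 * ((m + 2) * (5 * (m + 2) + 21) - 18 + 5 * p * (m + 5)) /
        (5 * p * ((m + 2) * (m + 3) * (m + 4) * (m + 5))) := by
    field_simp
    ring
  rw [hL, hR, div_le_div_iff₀ (by positivity) (by positivity), ← sub_nonneg]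
  subst hp
  ring_nf
  positivity

lemma baTerm_le_tailBound_sub {k : ℕ} (hk : 2 ≤ k) :
    baTerm k ≤ tailBound k - tailBound (k + 1) := by
  have hk' : (2 : ℝ) ≤ k := by exact_mod_cast hk
  unfold baTerm tailBound
  generalize (k : ℝ) = x at *
  obtain ⟨p, hp⟩ : ∃ p, p = x + 24 / 25 := ⟨_, rfl⟩
  have e1 : x + 23 / 50 = p - 1 / 2 := by rw [hp]; ring
  have e2 : x + 1 + 23 / 50 = p + 1 / 2 := by rw [hp]; ring
  have hp2 : 2 ≤ p := by linarith
  rw [e1, e2]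
  set t := Real.sqrt (5 / 2 * p) with ht
  have hx : 0 ≤ (x * (5 * x + 21) - 18) / (2 * (x + 3)) :=
    div_nonneg (by nlinarith) (by linarith)
  calc _ ≤ 4 / (x * (x + 1) * (x + 2)) *
        (t * (((x * (5 * x + 21) - 18) / (2 * (x + 3)) / (5 / 2 * p) + 1) / 2)) := by
        gcongr
        exact sqrt_le_sqrt_mul hx (by linarith)
    _ = t * (4 / (x * (x + 1) * (x + 2)) *
        (((x * (5 * x + 21) - 18) / (2 * (x + 3)) / (5 / 2 * p) + 1) / 2)) := by ring
    _ ≤ t * (8 / 3 * (1 - 1 / (4 * p) - 1 / (32 * p ^ 2) - 1 / (64 * p ^ 3)) / (p - 1 / 2) ^ 2 -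
      8 / 3 * (1 + 1 / (4 * p) - 1 / (32 * p ^ 2) + 1 / (128 * p ^ 3)) / (p + 1 / 2) ^ 2) :=
        mul_le_mul_of_nonneg_left (rational_step hk' hp) (Real.sqrt_nonneg _)
    _ = 8 / 3 * (t * (1 - 1 / (4 * p) - 1 / (32 * p ^ 2) - 1 / (64 * p ^ 3))) / (p - 1 / 2) ^ 2 -
      8 / 3 * (t * (1 + 1 / (4 * p) - 1 / (32 * p ^ 2) + 1 / (128 * p ^ 3))) /
        (p + 1 / 2) ^ 2 := by ring
    _ ≤ _ := by
        gcongr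
        · exact sqrt_mul_half_sub_ge hp2
        · exact sqrt_mul_half_add_le hp2

lemma sum_range_baTerm_le (m n : ℕ) (hm : 2 ≤ m) :
    ∑ i ∈ Finset.range n, baTerm (i + m) ≤ tailBound m := by
  have h : ∑ i ∈ Finset.range n, baTerm (i + m) ≤ tailBound m - tailBound ((n + m : ℕ) : ℝ) := by
    induction n with
    | zero => simp
    | succ n ih =>
      rw [Finset.sum_range_succ]
      have := baTerm_le_tailBound_sub (k := n + m) (by omega)
      rw [show n + 1 + m = n + m + 1 by ring, Nat.cast_succ]
      linarith
  have : 0 ≤ tailBound ((n + m : ℕ) : ℝ) := by unfold tailBound; positivity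
  linarith

lemma baTerm_nonneg (k : ℕ) : 0 ≤ baTerm k := by
  unfold baTerm; positivity

/-- A rational upper bound for `baTerm k`, accurate to about seven digits. -/
def baTermUpper (k : ℕ) : ℚ :=
  4 / (k * (k + 1) * (k + 2)) *
    ((Nat.sqrt (10 ^ 14 * (k * (5 * k + 21) - 18) / (2 * (k + 3))) + 1 : ℕ) / 10 ^ 7)

lemma sqrt_div_le_natSqrt (a b M : ℕ) (hb : 0 < b) (hM : 0 < M) :
    Real.sqrt ((a : ℝ) / b) ≤ (Nat.sqrt (M ^ 2 * a / b) + 1 : ℕ) / (M : ℝ) := by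
  have hb' : (0 : ℝ) < b := by exact_mod_cast hb
  have hM' : (0 : ℝ) < M := by exact_mod_cast hM
  apply Real.sqrt_le_iff.mpr ⟨by positivity, ?_⟩
  rw [div_pow, div_le_div_iff₀ hb' (by positivity)]
  have h := Nat.lt_succ_sqrt' (M ^ 2 * a / b)
  rw [Nat.div_lt_iff_lt_mul hb] at h
  rw [mul_comm (a : ℝ)]
  exact_mod_cast h.le

lemma baTerm_le_baTermUpper {k : ℕ} (hk : 2 ≤ k) : baTerm k ≤ baTermUpper k := by
  have h := sqrt_div_le_natSqrt (k * (5 * k + 21) - 18) (2 * (k + 3)) (10 ^ 7)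
    (by omega) (by norm_num)
  rw [Nat.cast_sub (by nlinarith)] at h
  unfold baTerm baTermUpper
  push_cast at h ⊢
  norm_num at h ⊢
  gcongr

lemma tailBound_le : tailBound 44 ≤ 8 / 3 * 10.542771 / 44.46 ^ 2 := by
  unfold tailBound
  rw [show (44 : ℝ) + 23 / 50 = 44.46 by norm_num]
  gcongr
  apply Real.sqrt_le_iff.mpr
  norm_num

lemma sum_baTermUpper_le :
    ∑ i ∈ Finset.range 42, baTermUpper (i + 2) ≤ 0.96 - 8 / 3 * 10.542771 / 44.46 ^ 2 := by
  decide +kernel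

/-- The series `∑_{k=2}^∞ (4/(k(k+1)(k+2))) √((k(5k+21) - 18)/(2(k+3)))` converges
and its sum is at most `0.96`. -/
theorem ba_series_le : Summable (fun k : ℕ => baTerm (k + 2)) ∧
    ∑' k : ℕ, baTerm (k + 2) ≤ 0.96 := by
  have hs : Summable (fun k : ℕ => baTerm (k + 2)) :=
    summable_of_sum_range_le (fun _ => baTerm_nonneg _)
      fun n => sum_range_baTerm_le 2 n le_rfl
  refine ⟨hs, ?_⟩
  have htail : ∑' i : ℕ, baTerm (i + 42 + 2) ≤ tailBound 44 :=
    Real.tsum_le_of_sum_range_le (fun _ => baTerm_nonneg _) fun n => by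
      simpa [add_assoc] using sum_range_baTerm_le 44 n (by norm_num)
  have hhead : ∑ i ∈ Finset.range 42, baTerm (i + 2) ≤
      0.96 - 8 / 3 * 10.542771 / 44.46 ^ 2 := by
    calc _ ≤ ∑ i ∈ Finset.range 42, (baTermUpper (i + 2) : ℝ) :=
          Finset.sum_le_sum fun i _ => baTerm_le_baTermUpper (by omega)
      _ ≤ ((0.96 - 8 / 3 * 10.542771 / 44.46 ^ 2 : ℚ) : ℝ) := by
          exact_mod_cast sum_baTermUpper_le
      _ = _ := by norm_num
  rw [← hs.sum_add_tsum_nat_add 42]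
  linarith [tailBound_le]
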